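/- Let s > 0. Then ℓ^{q₁}_{⟨k⟩^{s₁}}(ℤ^d) ⊂ ℓ^{q₂}_{⟨k⟩^{s₂}}(ℤ^d) holds if and only if either (q₁ ≤ q₂ and s₁ ≥ s₂) or (q₁ > q₂ and s₁/d + 1/q₁ > s₂/d + 1/q₂), where 0 < q₁, q₂ ≤ ∞ and s₁, s₂ ∈ ℝ. -/

import Mathlib

open scoped Real ENNReal

noncomputable section

/-- The Japanese bracket `⟨k⟩ = (1+|k|²)^{1/2}` on `ℤ^d` (Euclidean norm). -/
def jz {d : ℕ} (k : Fin d → ℤ) : ℝ := Real.sqrt (1 + ∑ i, ((k i : ℝ)) ^ 2)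

/-- The (quasi-)norm of the weighted sequence space `ℓ^q_{⟨·⟩^s}(ℤ^d)`,
for `0 < q ≤ ∞` (encoded as `q : ℝ≥0∞`). -/
def seqNorm {d : ℕ} (q : ℝ≥0∞) (s : ℝ) (a : (Fin d → ℤ) → ℂ) : ℝ≥0∞ :=
  if q = ∞ then ⨆ k, (‖a k‖₊ : ℝ≥0∞) * ENNReal.ofReal (jz k ^ s)
  else (∑' k, ((‖a k‖₊ : ℝ≥0∞) * ENNReal.ofReal (jz k ^ s)) ^ q.toReal) ^ (1 / q.toReal)

section Bracket

variable {d : ℕ}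

theorem one_le_jz (k : Fin d → ℤ) : 1 ≤ jz k :=
  Real.one_le_sqrt.2 (le_add_of_nonneg_right (by positivity))

theorem jz_pos (k : Fin d → ℤ) : 0 < jz k := one_pos.trans_le (one_le_jz k)

theorem abs_le_jz (k : Fin d → ℤ) (i : Fin d) : |(k i : ℝ)| ≤ jz k := by
  refine Real.abs_le_sqrt ?_
  have := Finset.single_le_sum (f := fun j => ((k j : ℝ)) ^ 2) (fun j _ => sq_nonneg _)
    (Finset.mem_univ i)
  linarith

theorem jz_le_of_abs_le (k : Fin d → ℤ) {M : ℝ} (hM : 1 ≤ M) (h : ∀ i, |(k i : ℝ)| ≤ M) :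
    jz k ≤ (d + 1) * M := by
  refine Real.sqrt_le_iff.2 ⟨by positivity, ?_⟩
  have hsum : ∑ i, ((k i : ℝ)) ^ 2 ≤ d * M ^ 2 := by
    calc ∑ i, ((k i : ℝ)) ^ 2 ≤ ∑ _i : Fin d, M ^ 2 :=
          Finset.sum_le_sum fun i _ => sq_le_sq' (abs_le.1 (h i)).1 (abs_le.1 (h i)).2
      _ = d * M ^ 2 := by simp
  have hd : (0 : ℝ) ≤ d := d.cast_nonneg
  have hM2 : 1 ≤ M ^ 2 := one_le_pow₀ hM
  nlinarith [mul_nonneg hd (sq_nonneg M), mul_nonneg (mul_nonneg hd hd) (sq_nonneg M)]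

theorem summable_jz_rpow {p : ℝ} (hp : p < -d) :
    Summable fun k : Fin d → ℤ => jz k ^ p := by
  have hp0 : p < 0 := hp.trans_le (by simp)
  set b := Pi.basisFun ℝ (Fin d)
  let L : Submodule ℤ (Fin d → ℝ) := Submodule.span ℤ (Set.range b)
  have hrank : Module.finrank ℤ L = d := by
    rw [ZLattice.rank ℝ L]; simp
  have hmem (k : Fin d → ℤ) : (fun i => (k i : ℝ)) ∈ L := by
    rw [Module.Basis.mem_span_iff_repr_mem]
    intro i
    simp [b]
  let e (k : Fin d → ℤ) : L := ⟨fun i => (k i : ℝ), hmem k⟩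
  have he : Function.Injective e := fun k l hkl => by
    funext i
    exact Int.cast_injective (congrFun (Subtype.ext_iff.1 hkl) i)
  have hs := (ZLattice.summable_norm_rpow L p (by rwa [hrank])).comp_injective he
  have h0 : Summable (Pi.single (0 : Fin d → ℤ) (1 : ℝ)) :=
    summable_of_hasFiniteSupport ((Set.finite_singleton 0).subset Pi.support_single_subset)
  refine Summable.of_nonneg_of_le (fun k => by have := jz_pos k; positivity) (fun k => ?_)
    (hs.add h0)
  by_cases hk : k = 0
  · subst hk
    refine (Real.rpow_le_one_of_one_le_of_nonpos (one_le_jz _) hp0.le).trans ?_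
    simp only [Function.comp_apply, Pi.single_eq_same]
    exact le_add_of_nonneg_left (by positivity)
  · have hpos : 0 < ‖e k‖ := by
      rw [norm_pos_iff]
      intro h
      exact hk (he (h.trans (Subtype.ext (by funext i; simp [e]))))
    have hle : ‖e k‖ ≤ jz k :=
      (pi_norm_le_iff_of_nonneg (jz_pos k).le).2 fun i => by simpa [e] using abs_le_jz k i
    simpa [hk] using Real.rpow_le_rpow_of_nonpos hpos hle hp0.le

end Bracket

theorem seqNorm_lt_top_iff {d : ℕ} {q : ℝ≥0∞} (hq : q ≠ 0) (s : ℝ) (a : (Fin d → ℤ) → ℂ) :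
    seqNorm q s a < ⊤ ↔ Memℓp (fun k => ‖a k‖ * jz k ^ s) q := by
  have hnn (k : Fin d → ℤ) : 0 ≤ ‖a k‖ * jz k ^ s := by have := jz_pos k; positivity
  have hterm (k : Fin d → ℤ) : (‖a k‖₊ : ℝ≥0∞) * ENNReal.ofReal (jz k ^ s) =
      ENNReal.ofReal (‖a k‖ * jz k ^ s) := by
    rw [ENNReal.ofReal_mul (norm_nonneg _), ofReal_norm]; rfl
  simp only [seqNorm, hterm]
  split_ifs with h
  · subst h
    rw [memℓp_infty_iff, lt_top_iff_ne_top]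
    simp only [Real.norm_of_nonneg (hnn _)]
    constructor
    · rintro hlt
      refine ⟨(⨆ k, ENNReal.ofReal (‖a k‖ * jz k ^ s)).toReal, ?_⟩
      rintro _ ⟨k, rfl⟩
      exact (ENNReal.ofReal_le_iff_le_toReal hlt).1 (le_iSup (fun k => ENNReal.ofReal _) k)
    · rintro ⟨C, hC⟩
      refine ne_top_of_le_ne_top (ENNReal.ofReal_ne_top (r := C)) (iSup_le fun k => ?_)
      exact ENNReal.ofReal_le_ofReal (hC ⟨k, rfl⟩)
  · have hq' : 0 < q.toReal := ENNReal.toReal_pos hq h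
    rw [memℓp_gen_iff hq', ENNReal.rpow_lt_top_iff_of_pos (by positivity)]
    simp only [Real.norm_of_nonneg (hnn _), ENNReal.ofReal_rpow_of_nonneg (hnn _) hq'.le]
    refine ⟨fun hlt => ?_, fun hs => hs.tsum_ofReal_lt_top⟩
    refine (ENNReal.summable_toReal hlt.ne).congr fun k => ?_
    exact ENNReal.toReal_ofReal (Real.rpow_nonneg (hnn k) _)

theorem Memℓp.extend {ι κ : Type*} {q : ℝ≥0∞} (hq : q ≠ 0) {e : ι → κ}
    (he : Function.Injective e) {b : ι → ℝ} (hb : Memℓp b q) :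
    Memℓp (Function.extend e b 0) q := by
  rcases eq_or_ne q ∞ with rfl | hq'
  · rw [memℓp_infty_iff] at hb ⊢
    obtain ⟨C, hC⟩ := hb
    refine ⟨max C 0, ?_⟩
    rintro _ ⟨k, rfl⟩
    by_cases hk : ∃ i, e i = k
    · obtain ⟨i, rfl⟩ := hk
      simpa [he.extend_apply] using Or.inl (hC ⟨i, rfl⟩)
    · simp [Function.extend_apply' _ _ _ hk]
  · have hpos := ENNReal.toReal_pos hq hq'
    rw [memℓp_gen_iff hpos] at hb ⊢
    refine (he.summable_iff fun k hk => ?_).1 (hb.congr fun i => ?_)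
    · rw [Function.extend_apply' _ _ _ hk]
      simp [hpos.ne']
    · simp [he.extend_apply]

theorem Memℓp.comp_injective {ι κ : Type*} {q : ℝ≥0∞} (hq : q ≠ 0) {e : ι → κ}
    (he : Function.Injective e) {b : κ → ℝ} (hb : Memℓp b q) : Memℓp (fun i => b (e i)) q := by
  rcases eq_or_ne q ∞ with rfl | hq'
  · rw [memℓp_infty_iff] at hb ⊢
    exact hb.mono (Set.range_comp_subset_range e fun k => ‖b k‖)
  · have hpos := ENNReal.toReal_pos hq hq'
    rw [memℓp_gen_iff hpos] at hb ⊢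
    exact hb.comp_injective he

/-- An inclusion of weighted spaces makes multiplication by `⟨·⟩^(s₂ - s₁)` map `ℓ^q₁` to `ℓ^q₂`
along every injective family of lattice points. -/
theorem memℓp_mul_jz_of_inclusion {d : ℕ} {q₁ q₂ : ℝ≥0∞} (hq₁ : q₁ ≠ 0) (hq₂ : q₂ ≠ 0)
    {s₁ s₂ : ℝ} (H : ∀ a : (Fin d → ℤ) → ℂ, seqNorm q₁ s₁ a < ⊤ → seqNorm q₂ s₂ a < ⊤)
    {ι : Type*} {e : ι → Fin d → ℤ} (he : Function.Injective e) {b : ι → ℝ} (hb0 : ∀ i, 0 ≤ b i)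
    (hb : Memℓp b q₁) : Memℓp (fun i => b i * jz (e i) ^ (s₂ - s₁)) q₂ := by
  let B : (Fin d → ℤ) → ℝ := Function.extend e b 0
  have hB0 (k) : 0 ≤ B k := by
    by_cases hk : ∃ i, e i = k
    · obtain ⟨i, rfl⟩ := hk
      simpa [B, he.extend_apply] using hb0 i
    · simp [B, Function.extend_apply' _ _ _ hk]
  let a (k : Fin d → ℤ) : ℂ := (B k * jz k ^ (-s₁) : ℝ)
  have ha (s : ℝ) (k) : ‖a k‖ * jz k ^ s = B k * jz k ^ (s - s₁) := by
    have hk := jz_pos k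
    rw [Complex.norm_real, Real.norm_of_nonneg (mul_nonneg (hB0 k) (by positivity)), mul_assoc,
      ← Real.rpow_add hk, neg_add_eq_sub]
  have h := H a
  rw [seqNorm_lt_top_iff hq₁, seqNorm_lt_top_iff hq₂] at h
  simp only [ha, sub_self, Real.rpow_zero, mul_one] at h
  simpa [B, he.extend_apply] using (h (hb.extend hq₁ he)).comp_injective hq₂ he

/-- The pointwise bound behind the embedding of `ℓ^p` into a weighted `ℓ^q` for `q < p`. -/
theorem mul_rpow_le_rpow_add_rpow {b w p q : ℝ} (hb : 0 ≤ b) (hw : 0 < w) (hq : 0 < q)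
    (hqp : q < p) : (b * w) ^ q ≤ b ^ p + w ^ (q * p / (p - q)) := by
  have hpq : 0 < p - q := sub_pos.2 hqp
  rcases le_total (w ^ (q / (p - q))) b with h | h
  · have hb' : 0 < b := (Real.rpow_pos_of_pos hw _).trans_le h
    have h1 : w ^ q ≤ b ^ (p - q) := by
      calc w ^ q = (w ^ (q / (p - q))) ^ (p - q) := by
            rw [← Real.rpow_mul hw.le, div_mul_cancel₀ _ hpq.ne']
        _ ≤ b ^ (p - q) := by gcongr
    calc (b * w) ^ q = b ^ q * w ^ q := Real.mul_rpow hb hw.le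
      _ ≤ b ^ q * b ^ (p - q) := by gcongr
      _ = b ^ p := by rw [← Real.rpow_add hb']; ring_nf
      _ ≤ _ := le_add_of_nonneg_right (by positivity)
  · calc (b * w) ^ q ≤ (w ^ (q / (p - q)) * w) ^ q := by gcongr
      _ = (w ^ (q / (p - q) + 1)) ^ q := by rw [Real.rpow_add_one hw.ne']
      _ = w ^ (q * p / (p - q)) := by
          rw [← Real.rpow_mul hw.le]
          congr 1
          field_simp
          ring
      _ ≤ _ := le_add_of_nonneg_left (by positivity)

theorem memℓp_mul_jz_of_lt {d : ℕ} (hd : 0 < d) {q₁ q₂ : ℝ≥0∞} (hq₂ : q₂ ≠ 0) (hq : q₂ < q₁)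
    {t : ℝ} (ht : t / d < 1 / q₁.toReal - 1 / q₂.toReal) {b : (Fin d → ℤ) → ℝ}
    (hb0 : ∀ k, 0 ≤ b k) (hb : Memℓp b q₁) : Memℓp (fun k => b k * jz k ^ t) q₂ := by
  have hd' : (0 : ℝ) < d := Nat.cast_pos.2 hd
  have hp₂ : 0 < q₂.toReal := ENNReal.toReal_pos hq₂ hq.ne_top
  rw [memℓp_gen_iff hp₂]
  have hnn (k) : 0 ≤ b k * jz k ^ t := mul_nonneg (hb0 k) (Real.rpow_nonneg (jz_pos k).le _)
  simp only [Real.norm_of_nonneg (hnn _)]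
  rcases eq_or_ne q₁ ∞ with rfl | hq₁
  · obtain ⟨C, hC⟩ := memℓp_infty_iff.1 hb
    have hexp : t * q₂.toReal < -d := by
      rw [ENNReal.toReal_top, div_zero, zero_sub, div_lt_iff₀ hd'] at ht
      calc t * q₂.toReal < -(1 / q₂.toReal) * d * q₂.toReal := by gcongr
        _ = -d := by field_simp
    refine Summable.of_nonneg_of_le (fun k => Real.rpow_nonneg (hnn k) _) (fun k => ?_)
      ((summable_jz_rpow hexp).mul_left (C ^ q₂.toReal))
    have hk := jz_pos k
    have hbC : b k ≤ C := (Real.le_norm_self _).trans (hC ⟨k, rfl⟩)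
    rw [Real.mul_rpow (hb0 k) (by positivity), ← Real.rpow_mul hk.le]
    have := hb0 k
    gcongr
  · have hlt : q₂.toReal < q₁.toReal := (ENNReal.toReal_lt_toReal hq.ne_top hq₁).2 hq
    have hp₁ := hp₂.trans hlt
    have hsub := sub_pos.2 hlt
    have hexp : t * (q₂.toReal * q₁.toReal / (q₁.toReal - q₂.toReal)) < -d := by
      rw [div_lt_iff₀ hd'] at ht
      calc t * (q₂.toReal * q₁.toReal / (q₁.toReal - q₂.toReal))
          < (1 / q₁.toReal - 1 / q₂.toReal) * d *
            (q₂.toReal * q₁.toReal / (q₁.toReal - q₂.toReal)) := by gcongr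
        _ = -d := by field_simp; ring
    rw [memℓp_gen_iff hp₁] at hb
    refine Summable.of_nonneg_of_le (fun k => Real.rpow_nonneg (hnn k) _) (fun k => ?_)
      (hb.add (summable_jz_rpow hexp))
    rw [Real.norm_of_nonneg (hb0 k), Real.rpow_mul (jz_pos k).le]
    exact mul_rpow_le_rpow_add_rpow (hb0 k) (Real.rpow_pos_of_pos (jz_pos k) _) hp₂ hlt

theorem seqNorm_lt_top_of_le {d : ℕ} {q₁ q₂ : ℝ≥0∞} (hq₁ : q₁ ≠ 0) (hq : q₁ ≤ q₂) {s₁ s₂ : ℝ}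
    (hs : s₂ ≤ s₁) {a : (Fin d → ℤ) → ℂ} (ha : seqNorm q₁ s₁ a < ⊤) : seqNorm q₂ s₂ a < ⊤ := by
  rw [seqNorm_lt_top_iff hq₁] at ha
  rw [seqNorm_lt_top_iff (pos_iff_ne_zero.1 ((pos_iff_ne_zero.2 hq₁).trans_le hq))]
  refine (ha.of_exponent_ge hq).mono fun k => ?_
  have hk := jz_pos k
  rw [Real.norm_of_nonneg (by positivity)]
  gcongr
  exact one_le_jz k

theorem seqNorm_lt_top_of_lt {d : ℕ} (hd : 0 < d) {q₁ q₂ : ℝ≥0∞} (hq₂ : q₂ ≠ 0) (hq : q₂ < q₁)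
    {s₁ s₂ : ℝ} (hs : s₂ / d + 1 / q₂.toReal < s₁ / d + 1 / q₁.toReal) {a : (Fin d → ℤ) → ℂ}
    (ha : seqNorm q₁ s₁ a < ⊤) : seqNorm q₂ s₂ a < ⊤ := by
  rw [seqNorm_lt_top_iff (pos_of_gt hq).ne'] at ha
  rw [seqNorm_lt_top_iff hq₂]
  have h := memℓp_mul_jz_of_lt hd hq₂ hq (t := s₂ - s₁) (by rw [sub_div]; linarith)
    (fun k => mul_nonneg (norm_nonneg _) (Real.rpow_nonneg (jz_pos k).le _)) ha
  convert h using 2 with k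
  rw [mul_assoc, ← Real.rpow_add (jz_pos k), add_sub_cancel]

section Dyadic

variable {d : ℕ}

/-- Parametrization of the lattice points in the disjoint dyadic cubes `[2^n, 2^(n+1))^d`. -/
def dyadicPoint (x : Σ n : ℕ, (Fin d → Fin (2 ^ n))) : Fin d → ℤ :=
  fun i => ((2 ^ x.1 + (x.2 i : ℕ) : ℕ) : ℤ)

theorem dyadicPoint_injective (hd : 0 < d) :
    Function.Injective (dyadicPoint : (Σ n : ℕ, (Fin d → Fin (2 ^ n))) → Fin d → ℤ) := by
  have hlog (x : Σ n : ℕ, (Fin d → Fin (2 ^ n))) (i : Fin d) :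
      Nat.log 2 (2 ^ x.1 + x.2 i) = x.1 :=
    Nat.log_eq_of_pow_le_of_lt_pow (by omega) (by have := (x.2 i).2; rw [pow_succ]; omega)
  intro x y hxy
  have hi (i) : 2 ^ x.1 + (x.2 i : ℕ) = 2 ^ y.1 + (y.2 i : ℕ) :=
    Int.ofNat_injective (congrFun hxy i)
  have hn : x.1 = y.1 := by rw [← hlog x ⟨0, hd⟩, hi, hlog]
  obtain ⟨n, v⟩ := x
  obtain ⟨m, w⟩ := y
  obtain rfl : n = m := hn
  congr 1
  funext i
  exact Fin.ext (by simpa using hi i)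

theorem two_pow_le_jz_dyadicPoint (hd : 0 < d) (x : Σ n : ℕ, (Fin d → Fin (2 ^ n))) :
    (2 : ℝ) ^ x.1 ≤ jz (dyadicPoint x) := by
  refine le_trans ?_ (abs_le_jz _ ⟨0, hd⟩)
  refine le_trans ?_ (le_abs_self _)
  simp [dyadicPoint]

theorem jz_dyadicPoint_le (x : Σ n : ℕ, (Fin d → Fin (2 ^ n))) :
    jz (dyadicPoint x) ≤ (2 * (d + 1)) * 2 ^ x.1 := by
  have h := jz_le_of_abs_le (dyadicPoint x) (M := 2 * 2 ^ x.1)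
    (by have := one_le_pow₀ (M₀ := ℝ) one_le_two (n := x.1); linarith) fun i => by
      have hv : ((x.2 i : ℕ) : ℝ) ≤ 2 ^ x.1 := by exact_mod_cast (x.2 i).2.le
      simp only [dyadicPoint]
      rw [Int.cast_natCast, Nat.abs_cast]
      push_cast
      linarith
  linarith

theorem exists_mul_rpow_le_jz_dyadicPoint_rpow (hd : 0 < d) (t : ℝ) :
    ∃ c : ℝ, 0 < c ∧ ∀ x : Σ n : ℕ, (Fin d → Fin (2 ^ n)),
      c * ((2 : ℝ) ^ x.1) ^ t ≤ jz (dyadicPoint x) ^ t := by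
  rcases le_total 0 t with ht | ht
  · refine ⟨1, one_pos, fun x => ?_⟩
    rw [one_mul]
    have := two_pow_le_jz_dyadicPoint hd x
    gcongr
  · refine ⟨(2 * (d + 1)) ^ t, by positivity, fun x => ?_⟩
    rw [← Real.mul_rpow (by positivity) (by positivity)]
    exact Real.rpow_le_rpow_of_nonpos (jz_pos _) (jz_dyadicPoint_le x) ht

/-- The sequence constant on dyadic cubes whose `ℓ^q` membership, for `u = 1 / q`, is that of
`(n + 1)^(-v)` on `ℕ`. -/
def dyadicSeq (u v : ℝ) (x : Σ n : ℕ, (Fin d → Fin (2 ^ n))) : ℝ :=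
  ((2 : ℝ) ^ x.1) ^ (-(d * u)) * ((x.1 : ℝ) + 1) ^ (-v)

theorem dyadicSeq_nonneg (u v : ℝ) (x : Σ n : ℕ, (Fin d → Fin (2 ^ n))) :
    0 ≤ dyadicSeq u v x := by
  unfold dyadicSeq; positivity

theorem memℓp_dyadicSeq_iff {q : ℝ≥0∞} (hq : 0 < q.toReal) (v : ℝ) :
    Memℓp (dyadicSeq (d := d) (1 / q.toReal) v) q ↔ 1 < v * q.toReal := by
  rw [memℓp_gen_iff hq]
  simp only [Real.norm_of_nonneg (dyadicSeq_nonneg _ _ _)]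
  rw [summable_sigma_of_nonneg fun x => Real.rpow_nonneg (dyadicSeq_nonneg _ _ _) _]
  have hsum (n : ℕ) : ∑' y : Fin d → Fin (2 ^ n),
      dyadicSeq (d := d) (1 / q.toReal) v ⟨n, y⟩ ^ q.toReal =
        1 / ((n : ℝ) + 1) ^ (v * q.toReal) := by
    simp only [dyadicSeq, tsum_fintype, Finset.sum_const, Finset.card_univ, Fintype.card_fun,
      Fintype.card_fin, nsmul_eq_mul]
    rw [Real.mul_rpow (by positivity) (by positivity), ← Real.rpow_mul (by positivity),
      ← Real.rpow_mul (by positivity), neg_mul, mul_assoc, one_div_mul_cancel hq.ne', mul_one,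
      Real.rpow_neg (by positivity), Real.rpow_natCast, neg_mul, Real.rpow_neg (by positivity)]
    push_cast
    field_simp
  simp only [hsum]
  have hN := summable_nat_add_iff (f := fun n : ℕ => 1 / (n : ℝ) ^ (v * q.toReal)) 1
  push_cast at hN
  rw [hN, Real.summable_one_div_nat_rpow]
  exact and_iff_right fun n => Summable.of_finite

end Dyadic

theorem weight_le_of_inclusion {d : ℕ} (hd : 0 < d) {q₁ q₂ : ℝ≥0∞} (hq₁ : q₁ ≠ 0) (hq₂ : q₂ ≠ 0)
    {s₁ s₂ : ℝ} (H : ∀ a : (Fin d → ℤ) → ℂ, seqNorm q₁ s₁ a < ⊤ → seqNorm q₂ s₂ a < ⊤) :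
    s₂ ≤ s₁ := by
  by_contra! hs
  have ht : 0 < s₂ - s₁ := sub_pos.2 hs
  have hq : min q₁ 1 ≠ 0 := by simp [min_eq_iff, hq₁]
  have hqpos : 0 < (min q₁ 1).toReal := ENNReal.toReal_pos hq (by simp)
  let x (n : ℕ) : Σ n : ℕ, (Fin d → Fin (2 ^ n)) := ⟨n, fun _ => ⟨0, by positivity⟩⟩
  have hx : Function.Injective x := fun n m h => congrArg Sigma.fst h
  set r : ℝ := 2 ^ (-((s₂ - s₁) / 2)) with hr
  have hr0 : 0 < r := by positivity
  have hr1 : r < 1 := Real.rpow_lt_one_of_one_lt_of_neg one_lt_two (by linarith)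
  have hb : Memℓp (fun n : ℕ => r ^ n) q₁ := by
    refine Memℓp.of_exponent_ge (q := min q₁ 1) ?_ (min_le_left _ _)
    rw [memℓp_gen_iff hqpos]
    refine (summable_geometric_of_lt_one (by positivity)
      (Real.rpow_lt_one hr0.le hr1 hqpos)).congr fun n => ?_
    rw [Real.norm_of_nonneg (by positivity), Real.rpow_pow_comm hr0.le]
  have h := ((memℓp_mul_jz_of_inclusion hq₁ hq₂ H ((dyadicPoint_injective hd).comp hx)
    (fun n => by positivity) hb).of_exponent_ge le_top)
  obtain ⟨C, hC⟩ := memℓp_infty_iff.1 h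
  obtain ⟨n, hn⟩ := pow_unbounded_of_one_lt C ((one_lt_inv₀ hr0).2 hr1)
  have hle := (Real.le_norm_self _).trans (hC ⟨n, rfl⟩)
  refine hle.not_gt (hn.trans_le ?_)
  have hrr : ((2 : ℝ) ^ n) ^ (s₂ - s₁) = r⁻¹ ^ n * r⁻¹ ^ n := by
    rw [← mul_pow, ← mul_inv, hr, ← Real.rpow_add two_pos, ← Real.rpow_neg two_pos.le,
      Real.rpow_pow_comm two_pos.le]
    ring_nf
  calc r⁻¹ ^ n = r ^ n * (r⁻¹ ^ n * r⁻¹ ^ n) := by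
        rw [← mul_assoc, ← mul_pow, mul_inv_cancel₀ hr0.ne', one_pow, one_mul]
    _ = r ^ n * ((2 : ℝ) ^ n) ^ (s₂ - s₁) := by rw [hrr]
    _ ≤ r ^ n * jz (dyadicPoint (x n)) ^ (s₂ - s₁) := by
        have := two_pow_le_jz_dyadicPoint hd (x n)
        gcongr

theorem index_lt_of_inclusion {d : ℕ} (hd : 0 < d) {q₁ q₂ : ℝ≥0∞} (hq₂ : q₂ ≠ 0) (hq : q₂ < q₁)
    {s₁ s₂ : ℝ} (H : ∀ a : (Fin d → ℤ) → ℂ, seqNorm q₁ s₁ a < ⊤ → seqNorm q₂ s₂ a < ⊤) :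
    s₂ / d + 1 / q₂.toReal < s₁ / d + 1 / q₁.toReal := by
  by_contra! hs
  have hd' : (0 : ℝ) < d := Nat.cast_pos.2 hd
  have hp₂ : 0 < q₂.toReal := ENNReal.toReal_pos hq₂ hq.ne_top
  have hb : Memℓp (dyadicSeq (d := d) (1 / q₁.toReal) (1 / q₂.toReal)) q₁ := by
    rcases eq_or_ne q₁ ∞ with rfl | hq₁
    · refine memℓp_infty ⟨1, ?_⟩
      rintro _ ⟨x, rfl⟩
      simp only [Real.norm_of_nonneg (dyadicSeq_nonneg _ _ _)]
      simpa [dyadicSeq] using Real.rpow_le_one_of_one_le_of_nonpos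
        (le_add_of_nonneg_left (Nat.cast_nonneg x.1)) (neg_nonpos.2 (inv_nonneg.2 hp₂.le))
    · have hlt : q₂.toReal < q₁.toReal := (ENNReal.toReal_lt_toReal hq.ne_top hq₁).2 hq
      rw [memℓp_dyadicSeq_iff (hp₂.trans hlt), one_div_mul_eq_div]
      exact (one_lt_div hp₂).2 hlt
  have h := memℓp_mul_jz_of_inclusion (pos_of_gt hq).ne' hq₂ H (dyadicPoint_injective hd)
    (dyadicSeq_nonneg _ _) hb
  obtain ⟨c, hc, hjz⟩ := exists_mul_rpow_le_jz_dyadicPoint_rpow hd (s₂ - s₁)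
  have hexp : -(d * (1 / q₂.toReal)) ≤ -(d * (1 / q₁.toReal)) + (s₂ - s₁) := by
    have := mul_le_mul_of_nonneg_left hs hd'.le
    rw [mul_add, mul_add, mul_div_cancel₀ _ hd'.ne', mul_div_cancel₀ _ hd'.ne'] at this
    linarith
  have hmem : Memℓp (dyadicSeq (d := d) (1 / q₂.toReal) (1 / q₂.toReal)) q₂ := by
    refine (h.const_mul c⁻¹).mono fun x => ?_
    rw [Real.norm_of_nonneg (dyadicSeq_nonneg _ _ _), le_inv_mul_iff₀ hc]
    calc c * dyadicSeq (1 / q₂.toReal) (1 / q₂.toReal) x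
        ≤ c * (((2 : ℝ) ^ x.1) ^ (-(d * (1 / q₁.toReal)) + (s₂ - s₁)) *
            ((x.1 : ℝ) + 1) ^ (-(1 / q₂.toReal))) := by
          unfold dyadicSeq
          gcongr
          exact one_le_pow₀ one_le_two
      _ = dyadicSeq (1 / q₁.toReal) (1 / q₂.toReal) x * (c * ((2 : ℝ) ^ x.1) ^ (s₂ - s₁)) := by
          rw [Real.rpow_add (by positivity), dyadicSeq]
          ring
      _ ≤ _ := mul_le_mul_of_nonneg_left (hjz x) (dyadicSeq_nonneg _ _ _)
  rw [memℓp_dyadicSeq_iff hp₂, one_div_mul_cancel hp₂.ne'] at hmem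
  exact lt_irrefl _ hmem

/-- `ℓ^{q₁}_{⟨·⟩^{s₁}}(ℤ^d) ⊂ ℓ^{q₂}_{⟨·⟩^{s₂}}(ℤ^d)` holds if and only if
either (`q₁ ≤ q₂` and `s₁ ≥ s₂`) or (`q₁ > q₂` and `s₁/d + 1/q₁ > s₂/d + 1/q₂`). -/
theorem seq_space_inclusion_iff (d : ℕ) (hd : 0 < d) (q₁ q₂ : ℝ≥0∞) (hq₁ : q₁ ≠ 0)
    (hq₂ : q₂ ≠ 0) (s₁ s₂ : ℝ) :
    (∀ a : (Fin d → ℤ) → ℂ, seqNorm q₁ s₁ a < ⊤ → seqNorm q₂ s₂ a < ⊤) ↔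
      ((q₁ ≤ q₂ ∧ s₁ ≥ s₂) ∨
        (q₂ < q₁ ∧ s₁ / d + 1 / q₁.toReal > s₂ / d + 1 / q₂.toReal)) := by
  refine ⟨fun H => ?_, ?_⟩
  · rcases le_or_gt q₁ q₂ with hq | hq
    · exact Or.inl ⟨hq, weight_le_of_inclusion hd hq₁ hq₂ H⟩
    · exact Or.inr ⟨hq, index_lt_of_inclusion hd hq₂ hq H⟩
  · rintro (⟨hq, hs⟩ | ⟨hq, hs⟩) a ha
    · exact seqNorm_lt_top_of_le hq₁ hq hs ha
    · exact seqNorm_lt_top_of_lt hd hq₂ hq hs ha
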